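/- Let A be a commutative Noetherian local domain with maximal ideal 𝔪 containing a subfield k such that the quotient map π : A → A/𝔪 restricts to an isomorphism k ≅ A/𝔪 (identify A/𝔪 with k). Let U be a vector space over k and let Φ : U × U → A be a symmetric k-bilinear map such that π(Φ(u,u)) ≠ 0 for every nonzero u ∈ U. Assume there exists a chain of prime ideals {0} = 𝔪₀ ⊆ 𝔪₁ ⊆ ⋯ ⊆ 𝔪_N = 𝔪 of A such that for each i < N the image of 𝔪_{i+1} in A/𝔪_i is a principal ideal. Then the A-bilinear extension of Φ to A ⊗_k U (determined by Φ(a⊗u, a'⊗u') = a·a'·Φ(u,u')) satisfies Φ(w,w) ≠ 0 for every nonzero w ∈ A ⊗_k U. -/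

import Mathlib

open TensorProduct

/-- Krull's intersection theorem for a Noetherian domain `R ⧸ I`, stated in `R`. -/
theorem Ideal.iInf_sup_pow_eq_of_isPrime {R : Type*} [CommRing R] [IsNoetherianRing R]
    (I K : Ideal R) [I.IsPrime] (h : I ⊔ K ≠ ⊤) : ⨅ n : ℕ, (I ⊔ K ^ n) = I := by
  refine le_antisymm (fun a ha => ?_) (le_iInf fun n => le_sup_left)
  have hK : K.map (Ideal.Quotient.mk I) ≠ ⊤ := by
    intro hK
    have := Ideal.comap_map_of_surjective' (Ideal.Quotient.mk I) Ideal.Quotient.mk_surjective K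
    rw [hK, Ideal.comap_top, Ideal.mk_ker] at this
    exact h (by rw [sup_comm, ← this])
  rw [← Ideal.Quotient.eq_zero_iff_mem, ← Ideal.mem_bot,
    ← Ideal.iInf_pow_eq_bot_of_isDomain _ hK, Ideal.mem_iInf]
  intro n
  have := Ideal.mem_map_of_mem (Ideal.Quotient.mk I) (Ideal.mem_iInf.mp ha n)
  rwa [Ideal.map_sup, Ideal.map_quotient_self, bot_sup_eq, Ideal.map_pow] at this

theorem Ideal.exists_le_sup_span_singleton_of_isPrincipal_map {R : Type*} [CommRing R]
    {I J : Ideal R} (hIJ : I ≤ J) (h : (J.map (Ideal.Quotient.mk I)).IsPrincipal) :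
    ∃ t ∈ J, J ≤ I ⊔ Ideal.span {t} := by
  obtain ⟨g, hg⟩ := h
  obtain ⟨t, rfl⟩ := Ideal.Quotient.mk_surjective g
  have hcomap := Ideal.comap_map_of_surjective' (Ideal.Quotient.mk I)
    Ideal.Quotient.mk_surjective
  have hJ := hcomap J
  have ht := hcomap (Ideal.span {t})
  rw [Ideal.mk_ker] at hJ ht
  rw [Ideal.map_span, Set.image_singleton, Ideal.span, ← hg, hJ, sup_of_le_left hIJ] at ht
  refine ⟨t, ?_, (ht.trans (sup_comm _ _)).le⟩
  rw [ht]
  exact Ideal.mem_sup_left (Ideal.mem_span_singleton_self t)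

theorem LinearMap.apply_mem_of_mem_smul_top {R M : Type*} [CommRing R] [AddCommGroup M]
    [Module R M] {I : Ideal R} (f : M →ₗ[R] R) {x : M} (hx : x ∈ I • (⊤ : Submodule R M)) :
    f x ∈ I := by
  simpa using Submodule.smul_top_le_comap_smul_top I f hx

theorem Module.Free.mem_iInf_smul_top {R M ι : Type*} [CommRing R] [AddCommGroup M]
    [Module R M] [Module.Free R M] (I : ι → Ideal R) {x : M}
    (hx : ∀ i, x ∈ I i • (⊤ : Submodule R M)) : x ∈ (⨅ i, I i) • (⊤ : Submodule R M) := by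
  let b := Module.Free.chooseBasis R M
  rw [← b.linearCombination_repr x, Finsupp.linearCombination_apply]
  exact Submodule.sum_mem _ fun j _ => Submodule.smul_mem_smul
    (Ideal.mem_iInf.mpr fun i => (b.coord j).apply_mem_of_mem_smul_top (hx i)) trivial

/-- Modulo `I`, the bilinear form `B` is anisotropic. -/
def LinearMap.AnisotropicMod {R M : Type*} [CommRing R] [AddCommGroup M] [Module R M]
    (B : M →ₗ[R] M →ₗ[R] R) (I : Ideal R) : Prop :=
  ∀ x, B x x ∈ I → x ∈ I • (⊤ : Submodule R M)

theorem LinearMap.apply_self_add_sub_mem {R M : Type*} [CommRing R] [AddCommGroup M]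
    [Module R M] (B : M →ₗ[R] M →ₗ[R] R) {I : Ideal R} (y : M) {z : M}
    (hz : z ∈ I • (⊤ : Submodule R M)) : B (z + y) (z + y) - B y y ∈ I := by
  have hl : B z (z + y) ∈ I := (B.flip (z + y)).apply_mem_of_mem_smul_top hz
  have hr : B y z ∈ I := (B y).apply_mem_of_mem_smul_top hz
  convert I.add_mem hl hr using 1
  simp only [map_add, LinearMap.add_apply]
  ring

theorem Submodule.exists_add_smul_of_mem_sup_smul_top {R M : Type*} [CommRing R]
    [AddCommGroup M] [Module R M] {I : Ideal R} {s : R} {x : M}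
    (hx : x ∈ (I ⊔ Ideal.span {s}) • (⊤ : Submodule R M)) :
    ∃ z ∈ I • (⊤ : Submodule R M), ∃ y, z + s • y = x := by
  rw [Submodule.sup_smul, Submodule.ideal_span_singleton_smul] at hx
  obtain ⟨z, hz, _, hy, rfl⟩ := Submodule.mem_sup.mp hx
  obtain ⟨y, -, rfl⟩ := (Submodule.mem_smul_pointwise_iff_exists _ _ _).mp hy
  exact ⟨z, hz, y, rfl⟩

theorem LinearMap.AnisotropicMod.of_le_sup_span_singleton {R M : Type*} [CommRing R]
    [IsNoetherianRing R] [AddCommGroup M] [Module R M] [Module.Free R M]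
    {B : M →ₗ[R] M →ₗ[R] R} {I J : Ideal R} [I.IsPrime] (hJ : J ≠ ⊤) (hIJ : I ≤ J) {t : R}
    (htJ : t ∈ J) (hJt : J ≤ I ⊔ Ideal.span {t}) (h : B.AnisotropicMod J) :
    B.AnisotropicMod I := by
  intro x hx
  by_cases htI : t ∈ I
  · obtain rfl : I = J := le_antisymm hIJ
      (hJt.trans (sup_le le_rfl ((Ideal.span_singleton_le_iff_mem I).mpr htI)))
    exact h x hx
  have hne : I ⊔ Ideal.span {t} ≠ ⊤ := fun htop => hJ (top_le_iff.mp
    (htop ▸ sup_le hIJ ((Ideal.span_singleton_le_iff_mem J).mpr htJ)))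
  rw [← Ideal.iInf_sup_pow_eq_of_isPrime I _ hne]
  refine Module.Free.mem_iInf_smul_top _ fun n => ?_
  induction n with
  | zero => simp [Ideal.one_eq_top]
  | succ n ih =>
    rw [Ideal.span_singleton_pow] at ih ⊢
    obtain ⟨z, hz, y, rfl⟩ := Submodule.exists_add_smul_of_mem_sup_smul_top ih
    have hsub := B.apply_self_add_sub_mem (t ^ n • y) hz
    rw [I.sub_mem_iff_right hx] at hsub
    simp only [map_smul, LinearMap.smul_apply, smul_eq_mul] at hsub
    have htn : t ^ n ∉ I := fun hmem => htI (Ideal.IsPrime.mem_of_pow_mem ‹_› n hmem)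
    have hyI : B y y ∈ I :=
      (Ideal.IsPrime.mem_or_mem ‹_›
        ((Ideal.IsPrime.mem_or_mem ‹_› hsub).resolve_left htn)).resolve_left htn
    have hyJ := Submodule.smul_mono_left hJt (h y (hIJ hyI))
    obtain ⟨z', hz', y', rfl⟩ := Submodule.exists_add_smul_of_mem_sup_smul_top hyJ
    rw [Submodule.sup_smul, smul_add, ← add_assoc, smul_smul, ← pow_succ]
    exact Submodule.add_mem_sup (Submodule.add_mem _ hz (Submodule.smul_mem _ _ hz'))
      (Submodule.smul_mem_smul (Ideal.mem_span_singleton_self _) trivial)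

theorem TensorProduct.exists_sub_one_tmul_mem_smul_top {k A U : Type*} [CommRing k]
    [CommRing A] [Algebra k A] [AddCommGroup U] [Module k U] {I : Ideal A}
    (hI : Function.Surjective ((Ideal.Quotient.mk I).comp (algebraMap k A))) (w : A ⊗[k] U) :
    ∃ u : U, w - (1 : A) ⊗ₜ[k] u ∈ I • (⊤ : Submodule A (A ⊗[k] U)) := by
  induction w with
  | zero => exact ⟨0, by simp⟩
  | tmul a u =>
    obtain ⟨c, hc⟩ := hI (Ideal.Quotient.mk I a)
    refine ⟨c • u, ?_⟩
    have hmem : a - algebraMap k A c ∈ I := Ideal.Quotient.eq.mp hc.symm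
    have heq : a ⊗ₜ[k] u - (1 : A) ⊗ₜ[k] (c • u) =
        (a - algebraMap k A c) • ((1 : A) ⊗ₜ[k] u) := by
      rw [← TensorProduct.smul_tmul, ← TensorProduct.sub_tmul, TensorProduct.smul_tmul',
        smul_eq_mul, mul_one, Algebra.algebraMap_eq_smul_one]
    rw [heq]
    exact Submodule.smul_mem_smul hmem trivial
  | add x y hx hy =>
    obtain ⟨u, hu⟩ := hx
    obtain ⟨v, hv⟩ := hy
    refine ⟨u + v, ?_⟩
    rw [TensorProduct.tmul_add, add_sub_add_comm]
    exact Submodule.add_mem _ hu hv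

/-- Let `A` be a commutative Noetherian local domain with maximal ideal `𝔪`
containing a subfield `k` such that the quotient map `π : A → A/𝔪` restricts to an isomorphism
`k ≅ A/𝔪`.  Let `U` be a `k`-vector space and `Φ : U × U → A` a symmetric `k`-bilinear map with
`π(Φ(u,u)) ≠ 0` for every nonzero `u`.  Assume there is a chain of prime ideals
`{0} = 𝔪₀ ⊆ 𝔪₁ ⊆ ⋯ ⊆ 𝔪_N = 𝔪` such that the image of `𝔪_{i+1}` in `A/𝔪_i` is principal.
Then the `A`-bilinear extension of `Φ` to `A ⊗[k] U` satisfies `Φ(w,w) ≠ 0` for every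
nonzero `w`. -/
theorem statement0
    {k A : Type*} [Field k] [CommRing A] [IsDomain A] [IsNoetherianRing A] [IsLocalRing A]
    [Algebra k A]
    (hres : Function.Bijective ((IsLocalRing.residue A).comp (algebraMap k A)))
    {U : Type*} [AddCommGroup U] [Module k U]
    (Φ : U →ₗ[k] U →ₗ[k] A)
    (hΦsymm : ∀ u v : U, Φ u v = Φ v u)
    (hΦaniso : ∀ u : U, u ≠ 0 → IsLocalRing.residue A (Φ u u) ≠ 0)
    (N : ℕ) (𝔪 : Fin (N + 1) → Ideal A)
    (h𝔪0 : 𝔪 0 = ⊥) (h𝔪N : 𝔪 (Fin.last N) = IsLocalRing.maximalIdeal A)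
    (h𝔪mono : Monotone 𝔪) (h𝔪prime : ∀ i, (𝔪 i).IsPrime)
    (h𝔪princ : ∀ i : Fin N,
      (Ideal.map (Ideal.Quotient.mk (𝔪 i.castSucc)) (𝔪 i.succ)).IsPrincipal)
    (Ψ : (A ⊗[k] U) →ₗ[A] (A ⊗[k] U) →ₗ[A] A)
    (hΨ : ∀ (a a' : A) (u u' : U), Ψ (a ⊗ₜ[k] u) (a' ⊗ₜ[k] u') = a * a' * Φ u u') :
    ∀ w : A ⊗[k] U, w ≠ 0 → Ψ w w ≠ 0 := by
  have hlast : Ψ.AnisotropicMod (𝔪 (Fin.last N)) := by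
    rw [h𝔪N]
    intro w hw
    obtain ⟨u, hu⟩ := TensorProduct.exists_sub_one_tmul_mem_smul_top hres.surjective w
    have hsub := Ψ.apply_self_add_sub_mem ((1 : A) ⊗ₜ[k] u) hu
    rw [sub_add_cancel, Submodule.sub_mem_iff_right _ hw, hΨ, one_mul, one_mul] at hsub
    have hu0 : u = 0 := by
      by_contra hne
      exact hΦaniso u hne ((IsLocalRing.residue_eq_zero_iff _).mpr hsub)
    simpa [hu0] using hu
  have hall : ∀ i, Ψ.AnisotropicMod (𝔪 i) := by
    intro i
    induction i using Fin.reverseInduction with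
    | last => exact hlast
    | cast i ih =>
      have hle : 𝔪 i.castSucc ≤ 𝔪 i.succ := h𝔪mono i.castSucc_lt_succ.le
      have := h𝔪prime i.castSucc
      obtain ⟨t, ht, hJt⟩ :=
        Ideal.exists_le_sup_span_singleton_of_isPrincipal_map hle (h𝔪princ i)
      exact ih.of_le_sup_span_singleton (h𝔪prime i.succ).ne_top hle ht hJt
  intro w hw hww
  refine hw ?_
  simpa [h𝔪0] using hall 0 w (by simp [hww])
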